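/- Let J be an almost complex structure on a neighborhood of 0 in ℂⁿ with J₀ = J_st and first-order coefficients L^i_{j̄k}, L^i_{j̄k̄}. Define Φ(w) = (w¹, …, w^{n−1}, wⁿ + (i/2)·Σ_{α,β} L^n_{ᾱβ} w̄^α w^β + (i/4)·Σ_{α,β} L^n_{ᾱβ̄} w̄^α w̄^β). Then Φ is a smooth diffeomorphism between neighborhoods of 0 with Φ(0) = 0 and dΦ₀ = Id, and the structure J′ expressed in the new coordinates, J′_w := (dΦ_w)^{−1} ∘ J_{Φ(w)} ∘ dΦ_w, satisfies J′₀ = J_st and its first-order coefficients satisfy L′^n_{ᾱβ} = 0 and L′^n_{ᾱβ̄} = ½(L^n_{ᾱβ̄} − L^n_{β̄ᾱ}) for all 1 ≤ α, β ≤ n−1; in particular L′^n_{ᾱβ̄} = −L′^n_{β̄ᾱ}, so J′ satisfies the standard-form condition on its first-order coefficients. -/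

import Mathlib

open Complex ComplexConjugate Finset

noncomputable section

/-- Standard complex structure of `ℂⁿ`: multiplication by `i`. -/
def Jstd (n : ℕ) : (Fin n → ℂ) →L[ℝ] (Fin n → ℂ) :=
  Complex.I • ContinuousLinearMap.id ℝ (Fin n → ℂ)

/-- The polarization of the quadratic form with coefficients `(i/2) A_{αβ}` on `w̄^α w^β` and
`(i/4) C_{αβ}` on `w̄^α w̄^β`. -/
def quadPolar {n : ℕ} (A C : Fin n → Fin n → ℂ) (z v : Fin (n+1) → ℂ) : ℂ :=
  (Complex.I / 2) * ∑ α : Fin n, ∑ β : Fin n,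
      A α β * (conj (z α.castSucc) * v β.castSucc + conj (v α.castSucc) * z β.castSucc)
    + (Complex.I / 4) * ∑ α : Fin n, ∑ β : Fin n,
      C α β * (conj (z α.castSucc) * conj (v β.castSucc)
        + conj (v α.castSucc) * conj (z β.castSucc))

theorem quadPolar_comm {n : ℕ} (A C : Fin n → Fin n → ℂ) (z v : Fin (n+1) → ℂ) :
    quadPolar A C z v = quadPolar A C v z := by
  simp only [quadPolar, add_comm]

theorem quadPolar_add_right {n : ℕ} (A C : Fin n → Fin n → ℂ) (z v v' : Fin (n+1) → ℂ) :
    quadPolar A C z (v + v') = quadPolar A C z v + quadPolar A C z v' := by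
  simp only [quadPolar, mul_sum, ← sum_add_distrib, Pi.add_apply, map_add]
  refine sum_congr rfl fun α _ => sum_congr rfl fun β _ => ?_
  ring

theorem quadPolar_smul_right {n : ℕ} (A C : Fin n → Fin n → ℂ) (r : ℝ)
    (z v : Fin (n+1) → ℂ) :
    quadPolar A C z (r • v) = r • quadPolar A C z v := by
  simp only [quadPolar, mul_sum, ← sum_add_distrib, Pi.smul_apply, Complex.real_smul, map_mul,
    Complex.conj_ofReal]
  refine sum_congr rfl fun α _ => sum_congr rfl fun β _ => ?_
  ring

/-- The bilinear map `quadPolar`, valued in the last coordinate direction. -/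
def quadPolarCLM {n : ℕ} (A C : Fin n → Fin n → ℂ) :
    (Fin (n+1) → ℂ) →L[ℝ] (Fin (n+1) → ℂ) →L[ℝ] (Fin (n+1) → ℂ) :=
  LinearMap.toContinuousBilinearMap
    ((LinearMap.mk₂ ℝ (quadPolar A C)
      (fun z z' v => by
        rw [quadPolar_comm, quadPolar_add_right, quadPolar_comm A C v, quadPolar_comm A C v])
      (fun r z v => by rw [quadPolar_comm, quadPolar_smul_right, quadPolar_comm])
      (quadPolar_add_right A C)
      (fun r => quadPolar_smul_right A C r)).compr₂
      (LinearMap.single ℝ (fun _ : Fin (n+1) => ℂ) (Fin.last n)))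

theorem quadPolarCLM_apply {n : ℕ} (A C : Fin n → Fin n → ℂ) (z v : Fin (n+1) → ℂ) :
    quadPolarCLM A C z v = Pi.single (Fin.last n) (quadPolar A C z v) := rfl

theorem quadPolarCLM_comm {n : ℕ} (A C : Fin n → Fin n → ℂ) (z v : Fin (n+1) → ℂ) :
    quadPolarCLM A C z v = quadPolarCLM A C v z := by
  rw [quadPolarCLM_apply, quadPolarCLM_apply, quadPolar_comm]

/-- The commutator of `J_st` with `quadPolar` extracts twice its antilinear part. -/
theorem quadPolar_commutator {n : ℕ} (A C : Fin n → Fin n → ℂ) (z v : Fin (n+1) → ℂ) :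
    Complex.I * quadPolar A C z v - quadPolar A C z (Complex.I • v) =
      -∑ α : Fin n, ∑ β : Fin n, (A α β * z β.castSucc
        + (1 / 2) * (C α β + C β α) * conj (z β.castSucc)) * conj (v α.castSucc) := by
  have hswap : ∑ α : Fin n, ∑ β : Fin n, C α β * (conj (z α.castSucc) * conj (v β.castSucc)) =
      ∑ α : Fin n, ∑ β : Fin n, C β α * (conj (z β.castSucc) * conj (v α.castSucc)) :=
    sum_comm
  have hsplit : Complex.I * quadPolar A C z v - quadPolar A C z (Complex.I • v) =
      -(∑ α : Fin n, ∑ β : Fin n, (A α β * z β.castSucc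
        + (1 / 2) * C α β * conj (z β.castSucc)) * conj (v α.castSucc)) -
      (1 / 2) *
        ∑ α : Fin n, ∑ β : Fin n, C α β * (conj (z α.castSucc) * conj (v β.castSucc)) := by
    simp only [quadPolar, mul_sum, ← sum_add_distrib, ← sum_sub_distrib, ← sum_neg_distrib,
      Pi.smul_apply, smul_eq_mul, map_mul, Complex.conj_I]
    refine sum_congr rfl fun α _ => sum_congr rfl fun β _ => ?_
    linear_combination (A α β * conj (v α.castSucc) * z β.castSucc
      + (1 / 2) * C α β * (conj (z α.castSucc) * conj (v β.castSucc)
        + conj (v α.castSucc) * conj (z β.castSucc))) * Complex.I_mul_I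
  rw [hsplit, hswap]
  simp only [mul_sum, ← sum_sub_distrib, ← sum_neg_distrib]
  refine sum_congr rfl fun α _ => sum_congr rfl fun β _ => ?_
  ring

/-- A smooth map whose derivative at a point is the identity is a smooth diffeomorphism between
open neighborhoods of the point and of its image. -/
theorem exists_bijOn_contDiffOn_invFunOn {E : Type*} [NormedAddCommGroup E] [NormedSpace ℝ E]
    [CompleteSpace E] {f : E → E} (hf : ContDiff ℝ (⊤ : ℕ∞) f) {a : E}
    (ha : fderiv ℝ f a = ContinuousLinearMap.id ℝ E) :
    ∃ V W : Set E, IsOpen V ∧ IsOpen W ∧ a ∈ V ∧ f a ∈ W ∧ Set.BijOn f V W ∧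
      ContDiffOn ℝ (⊤ : ℕ∞) (Function.invFunOn f V) W := by
  have hne : ((⊤ : ℕ∞) : WithTop ℕ∞) ≠ 0 := by simp
  have hda : HasFDerivAt f ((ContinuousLinearEquiv.refl ℝ E : E ≃L[ℝ] E) : E →L[ℝ] E) a := by
    have h := (hf.differentiable hne a).hasFDerivAt
    rwa [ha] at h
  let e := (hf.contDiffAt (x := a)).toOpenPartialHomeomorph f hda hne
  have hs : IsOpen {w | fderiv ℝ f w ∈ Set.range ((↑) : (E ≃L[ℝ] E) → E →L[ℝ] E)} :=
    ContinuousLinearEquiv.isOpen.preimage (hf.continuous_fderiv hne)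
  let e' := e.restrOpen _ hs
  have hVs : e'.source ⊆ {w | fderiv ℝ f w ∈ Set.range ((↑) : (E ≃L[ℝ] E) → E →L[ℝ] E)} :=
    fun w hw => hw.2
  have hae : a ∈ e'.source :=
    ⟨(hf.contDiffAt (x := a)).mem_toOpenPartialHomeomorph_source hda hne,
      ContinuousLinearEquiv.refl ℝ E, ha.symm⟩
  have hbij : Set.BijOn f e'.source e'.target := e'.bijOn
  refine ⟨e'.source, e'.target, e'.open_source, e'.open_target, hae, e'.map_source hae, hbij, ?_⟩
  have hsymm : ContDiffOn ℝ (⊤ : ℕ∞) e'.symm e'.target := by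
    intro y hy
    obtain ⟨g, hg⟩ := hVs (e'.map_target hy)
    refine (e'.contDiffAt_symm (f₀' := g) hy ?_ hf.contDiffAt).contDiffWithinAt
    rw [hg]
    exact (hf.differentiable hne _).hasFDerivAt
  refine hsymm.congr fun y hy => ?_
  refine hbij.injOn (Function.invFunOn_mem (hbij.surjOn hy)) (e'.map_target hy) ?_
  rw [Function.invFunOn_eq (hbij.surjOn hy)]
  exact (e'.right_inv hy).symm

/-- The derivative of `w ↦ w + ½ B(w, w)` for a symmetric bilinear `B`. -/
theorem hasFDerivAt_add_half_bilinear {E : Type*} [NormedAddCommGroup E] [NormedSpace ℝ E]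
    (B : E →L[ℝ] E →L[ℝ] E) (hB : ∀ z v, B z v = B v z) (w : E) :
    HasFDerivAt (fun w => w + (1 / 2 : ℝ) • B w w) (ContinuousLinearMap.id ℝ E + B w) w := by
  have h := (hasFDerivAt_id (𝕜 := ℝ) w).add
    ((B.hasFDerivAt_of_bilinear (hasFDerivAt_id (𝕜 := ℝ) w)
      (hasFDerivAt_id (𝕜 := ℝ) w)).const_smul (1 / 2 : ℝ))
  refine h.congr_fderiv ?_
  ext v
  simp [hB v w, ← add_smul]
  norm_num

/-- First-order part of the pullback of an endomorphism field `J` by a map tangent to the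
identity with second derivative `B`. -/
theorem hasFDerivAt_pullback {E : Type*} [NormedAddCommGroup E] [NormedSpace ℝ E]
    [CompleteSpace E] {J : E → E →L[ℝ] E} {f : E → E} {D : E → E →L[ℝ] E}
    {B : E →L[ℝ] E →L[ℝ] E} {L : E →L[ℝ] E →L[ℝ] E} {a : E}
    (hf : HasFDerivAt f (ContinuousLinearMap.id ℝ E) a) (hD : HasFDerivAt D B a)
    (hDa : D a = ContinuousLinearMap.id ℝ E) (hJ : HasFDerivAt J L (f a)) :
    ∃ T : E →L[ℝ] E →L[ℝ] E,
      HasFDerivAt (fun w => (D w).inverse.comp ((J (f w)).comp (D w))) T a ∧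
      ∀ z v, T z v = L z v + J (f a) (B z v) - B z (J (f a) v) := by
  have hinv : HasFDerivAt (fun w => (D w).inverse) (-B) a := by
    have h := hasFDerivAt_ringInverse (𝕜 := ℝ) (1 : (E →L[ℝ] E)ˣ)
    rw [ContinuousLinearMap.ringInverse_eq_inverse] at h
    have h1 : ((1 : (E →L[ℝ] E)ˣ) : E →L[ℝ] E) = D a := hDa.symm
    rw [h1] at h
    refine (h.comp a hD).congr_fderiv ?_
    ext z v
    simp
  refine ⟨_, hinv.clm_comp ((hJ.comp a hf).clm_comp hD), fun z v => ?_⟩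
  simp [hDa]
  abel

/-- the explicit quadratic change of coordinates `Φ` kills the coefficients
`L^n_{ᾱβ}` and antisymmetrizes the coefficients `L^n_{ᾱβ̄}` of an almost complex structure
`J` with `J₀ = J_st`, so that in the new coordinates the structure satisfies the
standard-form condition on its first-order coefficients.  (Ambient space `ℂ^{n+1}`, greek
indices in `Fin n` via `Fin.castSucc`, distinguished index `Fin.last n`.) -/
theorem stmt7 (n : ℕ) (hn : 1 ≤ n)
    (U : Set (Fin (n+1) → ℂ)) (hUopen : IsOpen U) (hU0 : (0 : Fin (n+1) → ℂ) ∈ U)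
    (J : (Fin (n+1) → ℂ) → ((Fin (n+1) → ℂ) →L[ℝ] (Fin (n+1) → ℂ)))
    (hJsmooth : ContDiffOn ℝ (⊤ : ℕ∞) J U)
    (hJacs : ∀ z ∈ U, ∀ v, J z (J z v) = -v)
    (hJ0 : J 0 = Jstd (n+1))
    (L1 L2 : Fin (n+1) → Fin (n+1) → Fin (n+1) → ℂ)
    (hL : ∀ (z v : Fin (n+1) → ℂ) (i : Fin (n+1)),
      fderiv ℝ J 0 z v i =
        ∑ j, ∑ k, (L1 i j k * z k + L2 i j k * conj (z k)) * conj (v j))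
    (Φ : (Fin (n+1) → ℂ) → (Fin (n+1) → ℂ))
    (hΦdef : ∀ w : Fin (n+1) → ℂ,
      (∀ α : Fin n, Φ w α.castSucc = w α.castSucc) ∧
      Φ w (Fin.last n) = w (Fin.last n)
        + (Complex.I / 2) * ∑ α : Fin n, ∑ β : Fin n,
            L1 (Fin.last n) α.castSucc β.castSucc * conj (w α.castSucc) * w β.castSucc
        + (Complex.I / 4) * ∑ α : Fin n, ∑ β : Fin n,
            L2 (Fin.last n) α.castSucc β.castSucc * conj (w α.castSucc) * conj (w β.castSucc))
    (J' : (Fin (n+1) → ℂ) → ((Fin (n+1) → ℂ) →L[ℝ] (Fin (n+1) → ℂ)))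
    (hJ'def : ∀ w, J' w =
      ((fderiv ℝ Φ w).inverse).comp ((J (Φ w)).comp (fderiv ℝ Φ w))) :
    -- Φ is a smooth diffeomorphism between neighborhoods of 0, Φ(0) = 0, dΦ₀ = Id
    ContDiff ℝ (⊤ : ℕ∞) Φ ∧ Φ 0 = 0 ∧
    fderiv ℝ Φ 0 = ContinuousLinearMap.id ℝ (Fin (n+1) → ℂ) ∧
    (∃ V W : Set (Fin (n+1) → ℂ), IsOpen V ∧ IsOpen W ∧
      (0 : Fin (n+1) → ℂ) ∈ V ∧ (0 : Fin (n+1) → ℂ) ∈ W ∧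
      Set.BijOn Φ V W ∧ ContDiffOn ℝ (⊤ : ℕ∞) (Function.invFunOn Φ V) W) ∧
    -- the transported structure J′ satisfies the standard-form condition
    J' 0 = Jstd (n+1) ∧
    (∃ L1' L2' : Fin (n+1) → Fin (n+1) → Fin (n+1) → ℂ,
      (∀ (z v : Fin (n+1) → ℂ) (i : Fin (n+1)),
        fderiv ℝ J' 0 z v i =
          ∑ j, ∑ k, (L1' i j k * z k + L2' i j k * conj (z k)) * conj (v j)) ∧
      (∀ α β : Fin n, L1' (Fin.last n) α.castSucc β.castSucc = 0) ∧
      (∀ α β : Fin n, L2' (Fin.last n) α.castSucc β.castSucc =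
        (1/2 : ℂ) * (L2 (Fin.last n) α.castSucc β.castSucc -
          L2 (Fin.last n) β.castSucc α.castSucc)) ∧
      (∀ α β : Fin n, L2' (Fin.last n) α.castSucc β.castSucc =
        - L2' (Fin.last n) β.castSucc α.castSucc)) := by
  set A : Fin n → Fin n → ℂ := fun α β => L1 (Fin.last n) α.castSucc β.castSucc with hA
  set C : Fin n → Fin n → ℂ := fun α β => L2 (Fin.last n) α.castSucc β.castSucc with hC
  set B := quadPolarCLM A C with hB
  have hΦ : Φ = fun w => w + (1 / 2 : ℝ) • B w w := by
    funext w i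
    refine Fin.lastCases ?_ (fun α => ?_) i
    · rw [(hΦdef w).2]
      simp only [Pi.add_apply, Pi.smul_apply, hB, quadPolarCLM_apply, Pi.single_eq_same,
        Complex.real_smul, quadPolar, ← two_mul, mul_sum, mul_add, add_assoc]
      push_cast
      congr 2 <;> refine sum_congr rfl fun α _ => sum_congr rfl fun β _ => ?_ <;> ring
    · rw [(hΦdef w).1 α]
      simp [hB, quadPolarCLM_apply, (Fin.castSucc_lt_last α).ne]
  have hdΦ : ∀ w, HasFDerivAt Φ (ContinuousLinearMap.id ℝ _ + B w) w := by
    rw [hΦ]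
    exact hasFDerivAt_add_half_bilinear B (quadPolarCLM_comm A C)
  have hsmooth : ContDiff ℝ (⊤ : ℕ∞) Φ := by
    rw [hΦ]
    fun_prop
  have hΦ0 : Φ 0 = 0 := by simp [hΦ]
  have hd0 : fderiv ℝ Φ 0 = ContinuousLinearMap.id ℝ (Fin (n+1) → ℂ) := by
    rw [(hdΦ 0).fderiv]
    simp
  have hJd : HasFDerivAt J (fderiv ℝ J 0) (Φ 0) := by
    rw [hΦ0]
    exact ((hJsmooth.contDiffAt (hUopen.mem_nhds hU0)).differentiableAt (by simp)).hasFDerivAt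
  have hD : HasFDerivAt (fderiv ℝ Φ) B 0 := by
    rw [funext fun w => (hdΦ w).fderiv]
    exact B.hasFDerivAt.const_add _
  obtain ⟨T, hT, hTapply⟩ := hasFDerivAt_pullback (hd0 ▸ (hdΦ 0).differentiableAt.hasFDerivAt)
    hD hd0 hJd
  rw [← funext hJ'def] at hT
  refine ⟨hsmooth, hΦ0, hd0, ?_, ?_, ?_⟩
  · have h := exists_bijOn_contDiffOn_invFunOn hsmooth hd0
    rwa [hΦ0] at h
  · rw [hJ'def, hd0, hΦ0, hJ0]
    ext v i
    simp
  refine ⟨fun i j k => L1 i j k - Fin.lastCases (motive := fun _ => ℂ)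
      (Fin.lastCases (motive := fun _ => ℂ) 0 (fun α => Fin.lastCases (motive := fun _ => ℂ) 0
        (fun β => A α β) k) j) (fun _ => 0) i,
    fun i j k => L2 i j k - Fin.lastCases (motive := fun _ => ℂ)
      (Fin.lastCases (motive := fun _ => ℂ) 0 (fun α => Fin.lastCases (motive := fun _ => ℂ) 0
        (fun β => (1 / 2) * (C α β + C β α)) k) j) (fun _ => 0) i, ?_, ?_, ?_, ?_⟩
  · intro z v i
    rw [hT.fderiv, hTapply, hΦ0, hJ0]
    have hst : ∀ u : Fin (n+1) → ℂ, Jstd (n+1) u = Complex.I • u := fun u => rfl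
    rw [hst, hst, Pi.sub_apply, Pi.add_apply, hL]
    refine Fin.lastCases ?_ (fun γ => ?_) i
    · rw [Pi.smul_apply, hB, quadPolarCLM_apply, quadPolarCLM_apply, Pi.single_eq_same,
        Pi.single_eq_same, smul_eq_mul, add_sub_assoc, quadPolar_commutator]
      simp only [Fin.sum_univ_castSucc, Fin.lastCases_last, Fin.lastCases_castSucc, sub_zero]
      simp only [sub_mul, add_mul, sum_add_distrib, sum_sub_distrib]
      ring
    · simp [hB, quadPolarCLM_apply, (Fin.castSucc_lt_last γ).ne]
  · intro α β
    simp [hA]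
  · intro α β
    simp only [Fin.lastCases_last, Fin.lastCases_castSucc, hC]
    ring
  · intro α β
    simp only [Fin.lastCases_last, Fin.lastCases_castSucc, hC]
    ring
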